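/- Let k be an even positive integer. Then for every positive integer n, the equality Φ_k(n) = n^{k−1}·φ(n)·∏_{p | n, p > 2} ( 1 − (-1)^{(k/2)·((p-1)/2)} / p^{k/2} ) holds in the rationals (or reals), the product being over the odd prime divisors p of n. -/

import Mathlib

/-- `Phi k n` is the number of `k`-tuples `(x_1,…,x_k) ∈ (ℤ/nℤ)^k`
with `gcd(x_1² + ⋯ + x_k², n) = 1`. -/
noncomputable def Phi (k n : ℕ) : ℕ :=
  Nat.card {x : Fin k → ZMod n // Nat.gcd (∑ i, (x i) ^ 2 : ZMod n).val n = 1}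

theorem Phi_eq_card_isUnit (k n : ℕ) [NeZero n] :
    Phi k n = Nat.card {x : Fin k → ZMod n // IsUnit (∑ i, (x i) ^ 2)} := by
  refine Nat.card_congr (Equiv.subtypeEquivRight fun x => ?_)
  rw [← Nat.coprime_iff_gcd_eq_one, ← ZMod.isUnit_iff_coprime, ZMod.natCast_zmod_val]

theorem Phi_mul_of_coprime (k : ℕ) {m n : ℕ} [NeZero m] [NeZero n] (h : m.Coprime n) :
    Phi k (m * n) = Phi k m * Phi k n := by
  rw [Phi_eq_card_isUnit, Phi_eq_card_isUnit, Phi_eq_card_isUnit, ← Nat.card_prod]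
  let e := ZMod.chineseRemainder h
  refine Nat.card_congr ((Equiv.subtypeEquiv
    ((Equiv.piCongrRight fun _ => e.toEquiv).trans (Equiv.arrowProdEquivProdArrow _ _ _))
    (q := fun y => IsUnit (∑ i, (y.1 i) ^ 2) ∧ IsUnit (∑ i, (y.2 i) ^ 2))
    fun x => ?_).trans (Equiv.subtypeProdEquivProd
      (p := fun y : Fin k → ZMod m => IsUnit (∑ i, (y i) ^ 2))
      (q := fun y : Fin k → ZMod n => IsUnit (∑ i, (y i) ^ 2))))
  rw [← MulEquiv.isUnit_map e, Prod.isUnit_iff]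
  simp [map_sum, Prod.fst_sum, Prod.snd_sum]

theorem AddMonoidHom.card_subtype_comp {G H : Type*} [AddGroup G] [AddGroup H] (f : G →+ H)
    (hf : Function.Surjective f) (P : H → Prop) :
    Nat.card {x // P (f x)} = Nat.card {y // P y} * Nat.card f.ker := by
  obtain ⟨s, hs⟩ := hf.hasRightInverse
  rw [← Nat.card_prod]
  exact Nat.card_congr
    { toFun := fun x => (⟨f x, x.2⟩, ⟨x - s (f x), by simp [AddMonoidHom.mem_ker, hs (f x)]⟩)
      invFun := fun y => ⟨y.2 + s y.1, by
        rw [map_add, AddMonoidHom.mem_ker.1 y.2.2, hs, zero_add]; exact y.1.2⟩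
      left_inv := fun x => by simp
      right_inv := fun y => by
        have h := AddMonoidHom.mem_ker.1 y.2.2
        ext <;> simp [h, hs y.1.1] }

theorem AddMonoidHom.card_subtype_comp_mul_card {G H : Type*} [AddGroup G] [AddGroup H]
    (f : G →+ H) (hf : Function.Surjective f) (P : H → Prop) :
    Nat.card {x // P (f x)} * Nat.card H = Nat.card {y // P y} * Nat.card G := by
  have h := f.card_subtype_comp hf fun _ => True
  rw [Nat.card_congr (Equiv.subtypeUnivEquiv fun _ => trivial),
    Nat.card_congr (Equiv.subtypeUnivEquiv fun _ => trivial)] at h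
  rw [f.card_subtype_comp hf P, h]
  ring

theorem Phi_prime_pow (k : ℕ) {p e : ℕ} (hp : p.Prime) (he : 0 < e) :
    Phi k (p ^ e) * p ^ k = Phi k p * (p ^ e) ^ k := by
  have : NeZero p := ⟨hp.ne_zero⟩
  let f : ZMod (p ^ e) →+* ZMod p := ZMod.castHom (dvd_pow_self p he.ne') (ZMod p)
  have hf : Function.Surjective f := ZMod.castHom_surjective _
  let g : (Fin k → ZMod (p ^ e)) →+ (Fin k → ZMod p) := f.toAddMonoidHom.compLeft (Fin k)
  have hg : Function.Surjective g := fun y => by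
    choose s hs using hf
    exact ⟨fun i => s (y i), funext fun i => hs (y i)⟩
  have h := g.card_subtype_comp_mul_card hg fun y => IsUnit (∑ i, (y i) ^ 2)
  simp only [Nat.card_fun, Nat.card_zmod, Nat.card_fin] at h
  rw [Phi_eq_card_isUnit, Phi_eq_card_isUnit, ← h]
  congr 1
  refine Nat.card_congr (Equiv.subtypeEquivRight fun x => ?_)
  have hu : ∀ a : ZMod (p ^ e), IsUnit a ↔ IsUnit (f a) := fun a => by
    rw [← ZMod.natCast_zmod_val a, map_natCast, ZMod.isUnit_iff_coprime, ZMod.isUnit_iff_coprime,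
      Nat.coprime_pow_right_iff he]
  rw [hu, map_sum]
  simp [g]

theorem Phi_two {k : ℕ} (hk : 0 < k) : Phi k 2 * 2 = 2 ^ k := by
  let f : (Fin k → ZMod 2) →+ ZMod 2 :=
    { toFun := fun x => ∑ i, x i
      map_zero' := by simp
      map_add' := fun x y => by simp [Finset.sum_add_distrib] }
  have hf : Function.Surjective f := fun a =>
    ⟨Pi.single ⟨0, hk⟩ a, by simp [f]⟩
  have h := f.card_subtype_comp_mul_card hf IsUnit
  have h1 : Nat.card {y : ZMod 2 // IsUnit y} = 1 := by
    simp
  simp only [Nat.card_fun, Nat.card_zmod, Nat.card_fin, h1, one_mul] at h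
  rw [Phi_eq_card_isUnit, ← h]
  congr 1
  refine Nat.card_congr (Equiv.subtypeEquivRight fun x => ?_)
  have hsq : ∀ a : ZMod 2, a ^ 2 = a := by decide
  simp [hsq, f]

section FiniteField

variable {F : Type*} [Field F] [Fintype F] [DecidableEq F]

theorem sum_comp_sq (hF : ringChar F ≠ 2) (g : F → ℤ) :
    ∑ a, g (a ^ 2) = ∑ t, (quadraticChar F t + 1) * g t := by
  rw [← Finset.sum_fiberwise Finset.univ (fun a : F => a ^ 2)]
  refine Finset.sum_congr rfl fun t _ => ?_
  rw [← quadraticChar_card_sqrts hF, Finset.sum_congr rfl (g := fun _ => g t)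
    (fun a ha => by rw [(Finset.mem_filter.1 ha).2]), Finset.sum_const, nsmul_eq_mul]
  congr 3
  ext a
  simp

theorem sum_quadraticChar_mul_sub (hF : ringChar F ≠ 2) (c : F) :
    ∑ t, quadraticChar F t * quadraticChar F (c - t) =
      quadraticChar F (-1) * ((if c = 0 then (Fintype.card F : ℤ) else 0) - 1) := by
  split_ifs with hc
  · subst hc
    have h : ∀ t : F, quadraticChar F t * quadraticChar F (0 - t) =
        quadraticChar F (-1) * if t = 0 then 0 else 1 := fun t => by
      rw [zero_sub, neg_eq_neg_one_mul, map_mul]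
      split_ifs with ht
      · simp [ht]
      · linear_combination quadraticChar F (-1) * quadraticChar_sq_one ht
    rw [Finset.sum_congr rfl fun t _ => h t, ← Finset.mul_sum]
    have h2 : ∀ t : F, (if t = 0 then 0 else 1 : ℤ) = 1 - if t = 0 then 1 else 0 := fun t => by
      split_ifs <;> rfl
    simp [h2]
  · have hJ := jacobiSum_nontrivial_inv (quadraticChar_ne_one hF)
    rw [(quadraticChar_isQuadratic F).inv, jacobiSum] at hJ
    rw [← Equiv.sum_comp (Equiv.mulLeft₀ c hc)]
    have h : ∀ t : F, quadraticChar F (c * t) * quadraticChar F (c - c * t) =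
        quadraticChar F t * quadraticChar F (1 - t) := fun t => by
      rw [← mul_one_sub, map_mul, map_mul]
      linear_combination quadraticChar F t * quadraticChar F (1 - t) * quadraticChar_sq_one hc
    exact (Finset.sum_congr rfl fun t _ => h t).trans (hJ.trans (by ring))

theorem sum_ite_sq_add_sq (hF : ringChar F ≠ 2) (c : F) :
    ∑ a : F, ∑ b : F, (if a ^ 2 + (b ^ 2 + c) = 0 then 1 else 0 : ℤ) =
      Fintype.card F - quadraticChar F (-1) +
        quadraticChar F (-1) * Fintype.card F * if c = 0 then 1 else 0 := by
  have hs : ∀ t : F, ∑ b : F, (if t + (b ^ 2 + c) = 0 then 1 else 0 : ℤ) =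
      quadraticChar F (-c - t) + 1 := fun t => by
    rw [sum_comp_sq hF fun s => if t + (s + c) = 0 then 1 else 0]
    have : ∀ s, t + (s + c) = 0 ↔ s = -c - t := fun s =>
      ⟨fun h => by linear_combination h, fun h => by linear_combination h⟩
    simp [this]
  rw [sum_comp_sq hF fun t => ∑ b : F, (if t + (b ^ 2 + c) = 0 then 1 else 0 : ℤ)]
  have h0 := quadraticChar_sum_zero hF
  have h1 : ∑ t : F, quadraticChar F (-c - t) = 0 := by
    rw [← h0]
    exact Equiv.sum_comp (Equiv.subLeft (-c)) fun t => quadraticChar F t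
  simp only [hs, add_mul, mul_add, Finset.sum_add_distrib, mul_one, one_mul, h0, h1,
    sum_quadraticChar_mul_sub hF, neg_eq_zero]
  split_ifs <;> simp <;> ring

theorem sum_ite_sum_sq (hF : ringChar F ≠ 2) (m : ℕ) :
    (Fintype.card F : ℤ) * ∑ x : Fin (2 * m) → F, (if ∑ i, (x i) ^ 2 = 0 then 1 else 0 : ℤ) =
      (Fintype.card F : ℤ) ^ (2 * m) +
        quadraticChar F (-1) ^ m * (Fintype.card F : ℤ) ^ m * (Fintype.card F - 1) := by
  induction m with
  | zero => simp
  | succ m ih =>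
    have hcons : ∀ (n : ℕ) (g : (Fin (n + 1) → F) → ℤ),
        ∑ x, g x = ∑ a : F, ∑ x : Fin n → F, g (Fin.cons a x) := fun n g => by
      rw [← Fintype.sum_prod_type', ← Equiv.sum_comp (Fin.consEquiv fun _ => F)]
      rfl
    have hsum : ∑ x : Fin (2 * m + 2) → F, (if ∑ i, (x i) ^ 2 = 0 then 1 else 0 : ℤ) =
        ∑ x : Fin (2 * m) → F, ∑ a : F, ∑ b : F,
          if a ^ 2 + (b ^ 2 + ∑ i, (x i) ^ 2) = 0 then 1 else 0 := by
      rw [hcons, Finset.sum_comm]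
      simp only [hcons (2 * m), Fin.sum_univ_succ (n := 2 * m + 1), Fin.sum_univ_succ (n := 2 * m),
        Fin.cons_zero, Fin.cons_succ]
      rw [Finset.sum_comm]
      exact Finset.sum_congr rfl fun x _ => Finset.sum_comm
    rw [mul_add_one 2 m, hsum]
    simp only [sum_ite_sq_add_sq hF, Finset.sum_add_distrib, ← Finset.mul_sum]
    simp only [Finset.sum_const, Finset.card_univ, Fintype.card_fun, Fintype.card_fin, nsmul_eq_mul]
    push_cast
    linear_combination quadraticChar F (-1) * (Fintype.card F : ℤ) * ih

end FiniteField

theorem Phi_odd_prime (m : ℕ) {p : ℕ} (hp : p.Prime) (hp2 : 2 < p) :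
    (p : ℤ) * Phi (2 * m) p =
      (p - 1) * p ^ m * (p ^ m - (-1) ^ (m * ((p - 1) / 2))) := by
  have : Fact p.Prime := ⟨hp⟩
  have hF : ringChar (ZMod p) ≠ 2 := by rw [ZMod.ringChar_zmod_n]; exact hp2.ne'
  have hodd : p % 2 = 1 := hp.eq_two_or_odd.resolve_left hp2.ne'
  have hχ : quadraticChar (ZMod p) (-1) = (-1) ^ ((p - 1) / 2) := by
    rw [quadraticChar_neg_one hF, ZMod.card, ZMod.χ₄_eq_neg_one_pow hodd]
    congr 1
    omega
  have h : (p : ℤ) * ∑ x : Fin (2 * m) → ZMod p, (if ∑ i, (x i) ^ 2 = 0 then 1 else 0 : ℤ) =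
      p ^ (2 * m) + (-1) ^ (m * ((p - 1) / 2)) * p ^ m * (p - 1) := by
    have h := sum_ite_sum_sq hF m
    rwa [ZMod.card, hχ, ← pow_mul, mul_comm ((p - 1) / 2)] at h
  have hΦ : (Phi (2 * m) p : ℤ) = ∑ x : Fin (2 * m) → ZMod p,
      (1 - if ∑ i, (x i) ^ 2 = 0 then 1 else 0 : ℤ) := by
    rw [Phi_eq_card_isUnit, Nat.card_eq_fintype_card, Fintype.card_subtype, Finset.card_filter]
    push_cast
    refine Finset.sum_congr rfl fun x _ => ?_
    simp only [isUnit_iff_ne_zero]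
    split_ifs <;> simp_all
  rw [hΦ, Finset.sum_sub_distrib]
  simp only [Finset.sum_const, Finset.card_univ, Fintype.card_fun, Fintype.card_fin, nsmul_eq_mul,
    ZMod.card]
  push_cast
  linear_combination -h

theorem Phi_even_eq (k : ℕ) (hk : 0 < k) (hkeven : Even k) (n : ℕ) (hn : 0 < n) :
    (Phi k n : ℝ) =
      (n : ℝ) ^ (k - 1) * (Nat.totient n : ℝ) *
        ∏ p ∈ n.primeFactors.filter (fun p => 2 < p),
          (1 - (-1 : ℝ) ^ ((k / 2) * ((p - 1) / 2)) / (p : ℝ) ^ (k / 2)) := by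
  induction n using Nat.recOnPosPrimePosCoprime with
  | zero => exact absurd hn (lt_irrefl 0)
  | one =>
    have : Phi k 1 = 1 := by
      rw [Phi_eq_card_isUnit, Nat.card_eq_one_iff_unique]
      exact ⟨inferInstance, ⟨⟨0, isUnit_of_subsingleton _⟩⟩⟩
    simp [this]
  | prime_pow p e hp he =>
    have hp0 : (p : ℝ) ≠ 0 := Nat.cast_ne_zero.2 hp.ne_zero
    have h := Phi_prime_pow k hp he
    have hR : (Phi k (p ^ e) : ℝ) * p ^ k = Phi k p * (p ^ e) ^ k := mod_cast h
    have ht : (Nat.totient (p ^ e) : ℝ) * p = p ^ e * (p - 1) := by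
      obtain ⟨e, rfl⟩ := Nat.exists_eq_succ_of_ne_zero he.ne'
      rw [Nat.totient_prime_pow_succ hp, Nat.cast_mul, Nat.cast_pred hp.pos]
      rw [Nat.succ_eq_add_one]
      push_cast
      ring
    have hpk : ((p : ℝ) ^ e) ^ k = (p ^ e) ^ (k - 1) * p ^ e := by
      rw [← pow_succ, Nat.sub_add_cancel hk]
    rw [hpk] at hR
    rw [Nat.primeFactors_prime_pow he.ne' hp, Finset.filter_singleton]
    refine mul_right_cancel₀ (mul_ne_zero (pow_ne_zero k hp0) hp0) ?_
    rw [← mul_assoc, hR]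
    push_cast
    split_ifs with hp2
    · obtain ⟨m, rfl⟩ := even_iff_exists_two_mul.1 hkeven
      have hΦ : (p : ℝ) * Phi (2 * m) p =
          (p - 1) * p ^ m * (p ^ m - (-1) ^ (m * ((p - 1) / 2))) :=
        mod_cast congrArg (Int.cast : ℤ → ℝ) (Phi_odd_prime m hp hp2)
      rw [Finset.prod_singleton, Nat.mul_div_cancel_left m two_pos]
      have hd : (1 - (-1 : ℝ) ^ (m * ((p - 1) / 2)) / (p : ℝ) ^ m) * p ^ m =
          p ^ m - (-1) ^ (m * ((p - 1) / 2)) := by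
        field_simp
      generalize (1 - (-1 : ℝ) ^ (m * ((p - 1) / 2)) / (p : ℝ) ^ m) = D at hd ⊢
      rw [← hd] at hΦ
      linear_combination ((p : ℝ) ^ e) ^ (2 * m - 1) * p ^ e * hΦ -
        ((p : ℝ) ^ e) ^ (2 * m - 1) * D * p ^ (2 * m) * ht
    · obtain rfl : p = 2 := le_antisymm (not_lt.1 hp2) hp.two_le
      have hΦ : (Phi k 2 : ℝ) * 2 = 2 ^ k := mod_cast Phi_two hk
      rw [Finset.prod_empty]
      push_cast at ht ⊢
      linear_combination ((2 : ℝ) ^ e) ^ (k - 1) * 2 ^ e * hΦ -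
        ((2 : ℝ) ^ e) ^ (k - 1) * 2 ^ k * ht
  | coprime a b ha hb hab iha ihb =>
    have : NeZero a := ⟨by omega⟩
    have : NeZero b := ⟨by omega⟩
    rw [Phi_mul_of_coprime k hab, Nat.cast_mul, iha (by omega), ihb (by omega),
      hab.primeFactors_mul, Finset.filter_union,
      Finset.prod_union (Finset.disjoint_filter_filter hab.disjoint_primeFactors),
      Nat.totient_mul hab]
    push_cast
    ring
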